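/- Let d(n,p) = 2^{20}/(n² p⁴). There exists N ∈ ℕ such that for all n ≥ N and all p with 2⁹ n^{−2/3} ≤ p ≤ e^{−52} 2^{−8} n^{−1/2}, the following holds with P_{n,p}-probability at least 1 − e^{−2n}: either there exists a pair (i,j) ∈ [n]×[n] with A(i,j) = B(i,j) = 1, or D(A,B) contains at least n/100 pairwise vertex-disjoint 4-cycles, each of whose two rows i < j satisfy j − i ≤ d(n,p). -/

import Mathlib

open MeasureTheory Filter Finset
open scoped ENNReal

noncomputable def entryWeight (p : ℝ) (b : Bool) : ℝ≥0∞ :=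
  if b then ENNReal.ofReal p else ENNReal.ofReal (1 - p)

noncomputable def pairWeight (n : ℕ) (p : ℝ)
    (ω : (Fin n → Fin n → Bool) × (Fin n → Fin n → Bool)) : ℝ≥0∞ :=
  (∏ i : Fin n, ∏ j : Fin n, entryWeight p (ω.1 i j)) *
    (∏ i : Fin n, ∏ j : Fin n, entryWeight p (ω.2 i j))

/-- The i.i.d. Bernoulli(p) measure `P_{n,p}` on pairs of n×n Boolean matrices. -/
noncomputable def gameMeasure (n : ℕ) (p : ℝ) :
    Measure ((Fin n → Fin n → Bool) × (Fin n → Fin n → Bool)) :=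
  Measure.sum fun ω => pairWeight n p ω • Measure.dirac ω

/-- A directed 2ℓ-cycle in the bipartite digraph D(A,B): ℓ distinct rows and ℓ distinct
columns with B(i_k, j_k) = 1 and A(i_{k+1}, j_k) = 1 for all k (indices mod ℓ). -/
def IsCycle (ℓ n : ℕ) (A B : Fin n → Fin n → Bool) (r c : ZMod ℓ → Fin n) : Prop :=
  Function.Injective r ∧ Function.Injective c ∧
    (∀ k, B (r k) (c k) = true) ∧ ∀ k, A (r (k + 1)) (c k) = true

/-- The product Bernoulli weight of a configuration. -/
noncomputable def bernWeight {E : Type*} [Fintype E] (p : ℝ) (x : E → Bool) : ℝ :=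
  ∏ e, if x e then p else 1 - p

open Classical in
/-- The probability of an event under the product Bernoulli weight. -/
noncomputable def bernProb {E : Type*} [Fintype E] [DecidableEq E] (p : ℝ) (Q : (E → Bool) → Prop) : ℝ :=
  ∑ x, bernWeight p x * if Q x then 1 else 0

section Bernoulli
variable {E : Type*} [Fintype E] {p : ℝ}

lemma bernWeight_nonneg (h0 : 0 ≤ p) (h1 : p ≤ 1) (x : E → Bool) : 0 ≤ bernWeight p x :=
  prod_nonneg fun e _ => by split_ifs <;> linarith

lemma sum_bernWeight [DecidableEq E] : ∑ x : E → Bool, bernWeight p x = 1 := by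
  unfold bernWeight
  have := (Finset.prod_univ_sum (fun _ : E => (univ : Finset Bool))
    (fun _ b => if b then p else 1 - p)).symm
  rw [Fintype.piFinset_univ] at this
  rw [this]
  simp

variable [DecidableEq E]

lemma bernProb_nonneg (h0 : 0 ≤ p) (h1 : p ≤ 1) (Q : (E → Bool) → Prop) : 0 ≤ bernProb p Q :=
  sum_nonneg fun x _ => mul_nonneg (bernWeight_nonneg h0 h1 x) (by split_ifs <;> norm_num)

lemma bernProb_mono (h0 : 0 ≤ p) (h1 : p ≤ 1) {Q Q' : (E → Bool) → Prop}
    (h : ∀ x, Q x → Q' x) : bernProb p Q ≤ bernProb p Q' := by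
  refine sum_le_sum fun x _ => mul_le_mul_of_nonneg_left ?_ (bernWeight_nonneg h0 h1 x)
  by_cases hq : Q x
  · simp [hq, h x hq]
  · rw [if_neg hq]; split_ifs <;> norm_num

lemma bernProb_true : bernProb p (fun _ : E → Bool => True) = 1 := by
  simp [bernProb, sum_bernWeight]

lemma bernProb_add_not (Q : (E → Bool) → Prop) :
    bernProb p Q + bernProb p (fun x => ¬ Q x) = 1 := by
  rw [← sum_bernWeight (E := E) (p := p), bernProb, bernProb, ← sum_add_distrib]
  refine sum_congr rfl fun x _ => ?_
  by_cases h : Q x <;> simp [h]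

lemma one_sub_le_bernProb {Q : (E → Bool) → Prop} {ε : ℝ}
    (h : bernProb p (fun x => ¬ Q x) ≤ ε) : 1 - ε ≤ bernProb p Q := by
  linarith [bernProb_add_not (p := p) Q]

lemma bernProb_and_add_and_not (Q G : (E → Bool) → Prop) :
    bernProb p (fun x => Q x ∧ G x) + bernProb p (fun x => Q x ∧ ¬ G x) = bernProb p Q := by
  rw [bernProb, bernProb, bernProb, ← sum_add_distrib]
  refine sum_congr rfl fun x _ => ?_
  by_cases h : Q x <;> by_cases h' : G x <;> simp [h, h']

lemma bernProb_exists_le {ι : Type*} (h0 : 0 ≤ p) (h1 : p ≤ 1) (s : Finset ι)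
    (Q : ι → (E → Bool) → Prop) :
    bernProb p (fun x => ∃ i ∈ s, Q i x) ≤ ∑ i ∈ s, bernProb p (Q i) := by
  classical
  unfold bernProb
  rw [sum_comm]
  refine sum_le_sum fun x _ => ?_
  rw [← mul_sum]
  refine mul_le_mul_of_nonneg_left ?_ (bernWeight_nonneg h0 h1 x)
  split_ifs with h
  · obtain ⟨i, hi, hq⟩ := h
    calc (1 : ℝ) = if Q i x then 1 else 0 := by simp [hq]
      _ ≤ _ := single_le_sum (f := fun i => if Q i x then (1 : ℝ) else 0)
        (fun i _ => by split_ifs <;> norm_num) hi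
  · exact sum_nonneg fun i _ => by split_ifs <;> norm_num

/-- Harris' inequality for an increasing and a decreasing event. -/
lemma bernProb_and_le_mul (h0 : 0 ≤ p) (h1 : p ≤ 1) {Q G : (E → Bool) → Prop}
    (hQ : Monotone Q) (hG : Antitone G) :
    bernProb p (fun x => Q x ∧ G x) ≤ bernProb p Q * bernProb p G := by
  classical
  have key := fkg (μ := bernWeight (E := E) p)
    (f := fun x => if Q x then (1 : ℝ) else 0) (g := fun x => if ¬ G x then (1 : ℝ) else 0)
    (fun x => bernWeight_nonneg h0 h1 x) (fun x => by dsimp; split_ifs <;> norm_num)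
    (fun x => by dsimp; split_ifs <;> norm_num)
    (fun x y hxy => by
      by_cases h : Q x
      · simp [h, hQ hxy h]
      · simp only [h, if_false]; split_ifs <;> norm_num)
    (fun x y hxy => by
      by_cases h : G y
      · simp [h, hG hxy h]
      · simp only [h]; split_ifs <;> simp_all)
    (fun x y => by
      rw [bernWeight, bernWeight, bernWeight, bernWeight, ← prod_mul_distrib, ← prod_mul_distrib]
      refine prod_le_prod (fun e _ => ?_) fun e _ => ?_
      · refine mul_nonneg ?_ ?_ <;> split_ifs <;> linarith
      · rw [Pi.inf_apply, Pi.sup_apply]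
        cases x e <;> cases y e <;> simp [mul_comm])
  rw [sum_bernWeight, one_mul] at key
  have e1 : ∑ x, bernWeight p x * ((if Q x then (1 : ℝ) else 0) * if ¬ G x then 1 else 0)
      = bernProb p (fun x => Q x ∧ ¬ G x) := by
    refine sum_congr rfl fun x _ => ?_
    by_cases h : Q x <;> by_cases h' : G x <;> simp [h, h']
  have e0 : ∑ x, bernWeight p x * (if ¬ G x then (1 : ℝ) else 0)
      = bernProb p (fun x => ¬ G x) := by
    refine sum_congr rfl fun x _ => ?_
    by_cases h : G x <;> simp [h]
  rw [e1, e0] at key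
  change bernProb p Q * _ ≤ _ at key
  have e2 := bernProb_and_add_and_not (p := p) Q G
  have e3 := bernProb_add_not (p := p) G
  rw [← eq_sub_iff_add_eq'] at e3
  rw [e3] at key
  linarith

/-- The event that all edges of `S` are present is independent of every event that ignores `S`. -/
lemma bernProb_forall_and (S : Finset E) {G : (E → Bool) → Prop}
    (hG : ∀ x y, (∀ e ∉ S, x e = y e) → (G x ↔ G y)) :
    bernProb p (fun x => (∀ e ∈ S, x e = true) ∧ G x) = p ^ #S * bernProb p G := by
  classical
  set Φ := Equiv.piEquivPiSubtypeProd (· ∈ S) (fun _ : E => Bool)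
  let g : ({e // e ∉ S} → Bool) → ℝ := fun z => if G (Φ.symm (fun _ => true, z)) then 1 else 0
  have hw : ∀ y z, bernWeight p (Φ.symm (y, z)) = bernWeight p y * bernWeight p z := by
    intro y z
    unfold bernWeight
    rw [← Fintype.prod_subtype_mul_prod_subtype (· ∈ S)]
    congr 1
    · exact prod_congr (by ext; simp) fun e _ => by simp [Φ, e.2]
    · exact prod_congr (by ext; simp) fun e _ => by simp [Φ, e.2]
  have hg : ∀ y z, G (Φ.symm (y, z)) ↔ G (Φ.symm (fun _ => true, z)) := by
    intro y z
    exact hG _ _ fun e he => by simp [Φ, he]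
  have hT : ∀ y z, (∀ e ∈ S, Φ.symm (y, z) e = true) ↔ y = fun _ => true := by
    intro y z
    constructor
    · intro h
      funext e
      simpa [Φ, e.2] using h e e.2
    · rintro rfl e he
      simp [Φ, he]
  have h1 : bernProb p G = ∑ z, bernWeight p z * g z := by
    rw [bernProb, ← Φ.symm.sum_comp, Fintype.sum_prod_type]
    simp_rw [hw, hg, mul_assoc, ← mul_sum, ← sum_mul, sum_bernWeight, one_mul]
    rfl
  have h2 : bernWeight p (fun _ : {e // e ∈ S} => true) = p ^ #S := by
    simp [bernWeight]
  rw [h1, ← h2, bernProb, ← Φ.symm.sum_comp, Fintype.sum_prod_type]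
  rw [sum_eq_single (fun _ => true)]
  · simp_rw [hw, hT, mul_sum]
    refine sum_congr rfl fun z _ => ?_
    simp [g]
  · intro y _ hy
    simp [hT, hy]
  · simp

/-- Janson's inequality for a family of edge sets of constant size whose overlaps are sparse. -/
lemma bernProb_forall_not_le {ι : Type*} [DecidableEq ι] (h0 : 0 ≤ p) (h1 : p ≤ 1)
    (S : ι → Finset E) (k : ℕ) (F : Finset ι) (hk : ∀ s ∈ F, #(S s) = k)
    (hov : ∀ s ∈ F, ∑ t ∈ F with t ≠ s ∧ ¬ Disjoint (S s) (S t), p ^ #(S t \ S s) ≤ 1 / 2) :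
    bernProb p (fun x => ∀ s ∈ F, ¬ ∀ e ∈ S s, x e = true) ≤ (1 - p ^ k / 2) ^ #F := by
  induction F using Finset.induction_on with
  | empty => simp [bernProb_true]
  | insert s F hs ih =>
    have ih := ih (fun t ht => hk t (mem_insert_of_mem ht)) (fun t ht => by
      refine le_trans ?_ (hov t (mem_insert_of_mem ht))
      exact sum_le_sum_of_subset_of_nonneg (filter_subset_filter _ (subset_insert _ _))
        fun _ _ _ => pow_nonneg h0 _)
    have hsk := hk s (mem_insert_self _ _)
    set H : (E → Bool) → Prop := fun x => ∀ t ∈ F, ¬ ∀ e ∈ S t, x e = true with hH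
    set G : (E → Bool) → Prop :=
      fun x => ∀ t ∈ F, Disjoint (S s) (S t) → ¬ ∀ e ∈ S t, x e = true with hGdef
    set B : (E → Bool) → Prop := fun x => ∀ e ∈ S s, x e = true with hB
    set O := F.filter fun t => ¬ Disjoint (S s) (S t) with hO
    have hGind : ∀ x y : E → Bool, (∀ e ∉ S s, x e = y e) → (G x ↔ G y) := by
      intro x y hxy
      refine forall₂_congr fun t _ => forall_congr' fun hd => not_congr ?_
      exact forall₂_congr fun e he => by rw [hxy e (disjoint_right.1 hd he)]
    have hGanti : Antitone G := by
      intro x y hxy hy t ht hd hx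
      refine hy t ht hd fun e he => ?_
      have := hxy e
      rw [hx e he] at this
      exact Bool.eq_true_of_true_le this
    have hBG : bernProb p (fun x => B x ∧ G x) = p ^ k * bernProb p G := by
      rw [← hsk]; exact bernProb_forall_and (S s) hGind
    have hBt : ∀ t ∈ O, bernProb p (fun x => (∀ e ∈ S s ∪ S t, x e = true) ∧ G x) ≤
        p ^ k * p ^ #(S t \ S s) * bernProb p G := by
      intro t _
      have hm : Monotone fun x : E → Bool => ∀ e ∈ S s ∪ S t, x e = true := by
        intro x y hxy hx e he
        have := hxy e
        rw [hx e he] at this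
        exact Bool.eq_true_of_true_le this
      refine (bernProb_and_le_mul h0 h1 hm hGanti).trans (le_of_eq ?_)
      have := bernProb_forall_and (p := p) (S s ∪ S t) (G := fun _ => True) (by simp)
      simp only [and_true, bernProb_true, mul_one] at this
      rw [this, ← union_sdiff_self_eq_union, card_union_of_disjoint disjoint_sdiff, hsk, pow_add]
    have hsum : bernProb p (fun x => B x ∧ G x) ≤ bernProb p (fun x => B x ∧ H x) +
        ∑ t ∈ O, bernProb p (fun x => (∀ e ∈ S s ∪ S t, x e = true) ∧ G x) := by
      rw [← bernProb_and_add_and_not _ H]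
      refine add_le_add (bernProb_mono h0 h1 fun x hx => ⟨hx.1.1, hx.2⟩) ?_
      refine le_trans ?_ (bernProb_exists_le h0 h1 O _)
      refine bernProb_mono h0 h1 ?_
      rintro x ⟨⟨hxB, hxG⟩, hxH⟩
      obtain ⟨t, ht, hx⟩ : ∃ t ∈ F, ∀ e ∈ S t, x e = true := by
        by_contra hc
        exact hxH fun t ht hx => hc ⟨t, ht, hx⟩
      refine ⟨t, mem_filter.2 ⟨ht, fun hd => hxG t ht hd hx⟩, fun e he => ?_, hxG⟩
      rcases mem_union.1 he with h | h
      exacts [hxB e h, hx e h]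
    have hO2 : ∑ t ∈ O, p ^ #(S t \ S s) ≤ 1 / 2 := by
      refine le_trans (le_of_eq ?_) (hov s (mem_insert_self _ _))
      refine sum_congr ?_ fun _ _ => rfl
      ext t
      simp only [hO, mem_filter, mem_insert]
      constructor
      · rintro ⟨ht, hd⟩
        exact ⟨Or.inr ht, fun h => hs (h ▸ ht), hd⟩
      · rintro ⟨h | h, hne, hd⟩
        exacts [absurd h hne, ⟨h, hd⟩]
    have hHG : bernProb p H ≤ bernProb p G := bernProb_mono h0 h1 fun x hx t ht _ => hx t ht
    have hpk : 0 ≤ p ^ k := pow_nonneg h0 k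
    have hlow : p ^ k / 2 * bernProb p H ≤ bernProb p (fun x => B x ∧ H x) := by
      have h3 := sum_le_sum hBt
      rw [← sum_mul, ← mul_sum] at h3
      have h4 : p ^ k * ∑ t ∈ O, p ^ #(S t \ S s) ≤ p ^ k * (1 / 2) :=
        mul_le_mul_of_nonneg_left hO2 hpk
      have h5 := mul_le_mul_of_nonneg_right h4 (bernProb_nonneg h0 h1 G)
      have h6 := mul_le_mul_of_nonneg_left hHG (by positivity : 0 ≤ p ^ k / 2)
      linarith
    have hsplit := bernProb_and_add_and_not (p := p) H B
    have hcomm : bernProb p (fun x => H x ∧ B x) = bernProb p (fun x => B x ∧ H x) := by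
      simp only [and_comm]
    have hgoal : bernProb p (fun x => ∀ t ∈ insert s F, ¬ ∀ e ∈ S t, x e = true) =
        bernProb p (fun x => H x ∧ ¬ B x) := by
      simp only [forall_mem_insert, hH, hB, and_comm]
    have hp1 : p ^ k ≤ 1 := pow_le_one₀ h0 h1
    rw [hgoal, card_insert_of_notMem hs, pow_succ]
    calc _ ≤ bernProb p H * (1 - p ^ k / 2) := by linarith
      _ ≤ _ := mul_le_mul_of_nonneg_right ih (by linarith)

end Bernoulli

section Family
variable {n : ℕ}

/-- The four edges of the cycle through rows `q.1` and columns `q.2`; the Boolean label tells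
whether an edge belongs to `A` or to `B`. -/
def cycleEdges (q : (Fin n × Fin n) × (Fin n × Fin n)) : Finset (Bool × Fin n × Fin n) :=
  {(false, q.1.1, q.2.1), (false, q.1.2, q.2.2), (true, q.1.2, q.2.1), (true, q.1.1, q.2.2)}

/-- Pairs of rows avoiding `R` at distance at most `D`. -/
def nearPairs (D : ℕ) (R : Finset (Fin n)) : Finset (Fin n × Fin n) :=
  {i | i.1 ∉ R ∧ i.2 ∉ R ∧ i.1 < i.2 ∧ i.2.val ≤ i.1.val + D}

/-- Columns avoiding `C` in the lower half. -/
def lowCols (C : Finset (Fin n)) : Finset (Fin n) := {j | j ∉ C ∧ 2 * j.val < n}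

/-- Columns avoiding `C` in the upper half. -/
def highCols (C : Finset (Fin n)) : Finset (Fin n) := {j | j ∉ C ∧ n ≤ 2 * j.val}

lemma card_cycleEdges {q : (Fin n × Fin n) × (Fin n × Fin n)} (h : q.2.1 ≠ q.2.2) :
    #(cycleEdges q) = 4 := by
  unfold cycleEdges
  rw [card_insert_of_notMem, card_insert_of_notMem, card_insert_of_notMem, card_singleton] <;>
    simp [h]

lemma sum_ite_add_ite_le {α : Type*} [DecidableEq α] (P : Finset (α × α)) (K : ℕ)
    (h1 : ∀ a, #{i ∈ P | i.1 = a} ≤ K) (h2 : ∀ b, #{i ∈ P | i.2 = b} ≤ K) (a b : α) :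
    ∑ i ∈ P, ((if i.1 = a then (1 : ℝ) else 0) + if i.2 = b then 1 else 0) ≤ 2 * K := by
  rw [sum_add_distrib, sum_boole, sum_boole, two_mul]
  exact add_le_add (by exact_mod_cast h1 a) (by exact_mod_cast h2 b)

lemma sum_ite_mul_ite_le {α : Type*} [DecidableEq α] (P : Finset (α × α)) (a b : α) :
    ∑ i ∈ P, ((if i.1 = a then (1 : ℝ) else 0) * if i.2 = b then 1 else 0) ≤ 1 := by
  have hite : ∀ i : α × α, ((if i.1 = a then (1 : ℝ) else 0) * if i.2 = b then 1 else 0) =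
      if i.1 = a ∧ i.2 = b then 1 else 0 := fun i => by
    by_cases h : i.1 = a <;> by_cases h' : i.2 = b <;> simp [h, h']
  rw [sum_congr rfl fun i _ => hite i, sum_boole]
  have : #{i ∈ P | i.1 = a ∧ i.2 = b} ≤ 1 := card_le_one.2 fun x hx y hy => by
    simp only [mem_filter] at hx hy
    exact Prod.ext (hx.2.1.trans hy.2.1.symm) (hx.2.2.trans hy.2.2.symm)
  exact_mod_cast this

lemma pow_card_sdiff_cycleEdges_le {p : ℝ} (h0 : 0 ≤ p)
    {s t : (Fin n × Fin n) × (Fin n × Fin n)} (ht : t.2.1 ≠ t.2.2) (hst : t.2.1 ≠ s.2.2)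
    (hts : t.2.2 ≠ s.2.1) (hne : t ≠ s) (hd : ¬ Disjoint (cycleEdges s) (cycleEdges t)) :
    p ^ #(cycleEdges t \ cycleEdges s) ≤
      p ^ 3 * (((if t.1.1 = s.1.1 then (1 : ℝ) else 0) + if t.1.2 = s.1.2 then 1 else 0) *
          ((if t.2.1 = s.2.1 then (1 : ℝ) else 0) + if t.2.2 = s.2.2 then 1 else 0)) +
      p ^ 2 * (((if t.1.1 = s.1.1 then (1 : ℝ) else 0) + if t.1.2 = s.1.2 then 1 else 0) *
          ((if t.2.1 = s.2.1 then (1 : ℝ) else 0) * if t.2.2 = s.2.2 then 1 else 0)) +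
      p ^ 2 * (((if t.1.1 = s.1.1 then (1 : ℝ) else 0) * if t.1.2 = s.1.2 then 1 else 0) *
          ((if t.2.1 = s.2.1 then (1 : ℝ) else 0) + if t.2.2 = s.2.2 then 1 else 0)) := by
  obtain ⟨⟨i₁, i₂⟩, j₁, j₂⟩ := s
  obtain ⟨⟨i₁', i₂'⟩, j₁', j₂'⟩ := t
  dsimp only at ht hst hts ⊢
  have hprod : p ^ #(cycleEdges ((i₁', i₂'), j₁', j₂') \ cycleEdges ((i₁, i₂), j₁, j₂)) =
      ∏ e ∈ cycleEdges ((i₁', i₂'), j₁', j₂'),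
        if e ∈ cycleEdges ((i₁, i₂), j₁, j₂) then 1 else p := by
    rw [prod_ite, prod_const_one, one_mul, prod_const, sdiff_eq_filter]
  have hd' : (i₁' = i₁ ∨ i₂' = i₂) ∧ (j₁' = j₁ ∨ j₂' = j₂) := by
    rw [not_disjoint_iff] at hd
    obtain ⟨e, hs, ht'⟩ := hd
    simp only [cycleEdges, mem_insert, mem_singleton] at hs ht'
    rcases hs with rfl | rfl | rfl | rfl <;> simp at ht' <;> grind
  have hne' : ¬ (i₁' = i₁ ∧ i₂' = i₂ ∧ j₁' = j₁ ∧ j₂' = j₂) := by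
    rintro ⟨rfl, rfl, rfl, rfl⟩; exact hne rfl
  have h2 : 0 ≤ p ^ 2 := pow_nonneg h0 2
  have h3 : 0 ≤ p ^ 3 := pow_nonneg h0 3
  rw [hprod]
  unfold cycleEdges
  rw [prod_insert (by simp [ht]), prod_insert (by simp), prod_insert (by simp [ht]),
    prod_singleton]
  simp only [mem_insert, mem_singleton, Prod.mk.injEq, hst, hts, and_false, false_and, or_false,
    false_or, true_and, reduceCtorEq]
  by_cases a : i₁' = i₁ <;> by_cases b : i₂' = i₂ <;> by_cases c : j₁' = j₁ <;>
    by_cases e : j₂' = j₂ <;> simp only [a, b, c, e, if_true, if_false, and_self, and_true,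
      and_false, true_and, false_and, or_self, not_true_eq_false] at hd' hne' ⊢ <;> nlinarith

lemma sum_overlap_le {p : ℝ} (h0 : 0 ≤ p) (P Q : Finset (Fin n × Fin n)) (K L : ℕ)
    (hP1 : ∀ a, #{i ∈ P | i.1 = a} ≤ K) (hP2 : ∀ b, #{i ∈ P | i.2 = b} ≤ K)
    (hQ1 : ∀ a, #{i ∈ Q | i.1 = a} ≤ L) (hQ2 : ∀ b, #{i ∈ Q | i.2 = b} ≤ L)
    (hQ : ∀ j ∈ Q, ∀ j' ∈ Q, j.1 ≠ j'.2)
    {s : (Fin n × Fin n) × (Fin n × Fin n)} (hs : s ∈ P ×ˢ Q) :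
    ∑ t ∈ P ×ˢ Q with t ≠ s ∧ ¬ Disjoint (cycleEdges s) (cycleEdges t),
      p ^ #(cycleEdges t \ cycleEdges s) ≤
        p ^ 3 * ((2 * K) * (2 * L)) + p ^ 2 * ((2 * K) * 1) + p ^ 2 * (1 * (2 * L)) := by
  have hsQ := (mem_product.1 hs).2
  refine (sum_le_sum (g := fun t =>
      p ^ 3 * (((if t.1.1 = s.1.1 then (1 : ℝ) else 0) + if t.1.2 = s.1.2 then 1 else 0) *
          ((if t.2.1 = s.2.1 then (1 : ℝ) else 0) + if t.2.2 = s.2.2 then 1 else 0)) +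
      p ^ 2 * (((if t.1.1 = s.1.1 then (1 : ℝ) else 0) + if t.1.2 = s.1.2 then 1 else 0) *
          ((if t.2.1 = s.2.1 then (1 : ℝ) else 0) * if t.2.2 = s.2.2 then 1 else 0)) +
      p ^ 2 * (((if t.1.1 = s.1.1 then (1 : ℝ) else 0) * if t.1.2 = s.1.2 then 1 else 0) *
          ((if t.2.1 = s.2.1 then (1 : ℝ) else 0) + if t.2.2 = s.2.2 then 1 else 0))) fun t ht => ?_).trans
    ((sum_le_sum_of_subset_of_nonneg (filter_subset _ _) fun t _ _ => ?_).trans ?_)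
  · obtain ⟨htF, hne, hd⟩ := mem_filter.1 ht
    have htQ := (mem_product.1 htF).2
    exact pow_card_sdiff_cycleEdges_le h0 (hQ _ htQ _ htQ) (hQ _ htQ _ hsQ)
      (hQ _ hsQ _ htQ).symm hne hd
  · positivity
  · rw [sum_add_distrib, sum_add_distrib, ← mul_sum, ← mul_sum, ← mul_sum]
    have hmul : ∀ (f g : Fin n × Fin n → ℝ) (a b : ℝ), (∀ i, 0 ≤ f i) → (∀ i, 0 ≤ g i) →
        ∑ i ∈ P, f i ≤ a → ∑ i ∈ Q, g i ≤ b → ∑ t ∈ P ×ˢ Q, f t.1 * g t.2 ≤ a * b := by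
      intro f g a b hf hg ha hb
      rw [sum_product, ← sum_mul_sum]
      exact mul_le_mul ha hb (sum_nonneg fun i _ => hg i) ((sum_nonneg fun i _ => hf i).trans ha)
    have uP := sum_ite_add_ite_le P K hP1 hP2 s.1.1 s.1.2
    have uQ := sum_ite_add_ite_le Q L hQ1 hQ2 s.2.1 s.2.2
    have vP := sum_ite_mul_ite_le P s.1.1 s.1.2
    have vQ := sum_ite_mul_ite_le Q s.2.1 s.2.2
    refine add_le_add (add_le_add ?_ ?_) ?_
    · refine mul_le_mul_of_nonneg_left (hmul _ _ _ _ ?_ ?_ uP uQ) (by positivity) <;>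
        (intro i; positivity)
    · refine mul_le_mul_of_nonneg_left (hmul _ _ _ _ ?_ ?_ uP vQ) (by positivity) <;>
        (intro i; positivity)
    · refine mul_le_mul_of_nonneg_left (hmul _ _ _ _ ?_ ?_ vP uQ) (by positivity) <;>
        (intro i; positivity)

lemma card_nearPairs_fst_le (D : ℕ) (R : Finset (Fin n)) (a : Fin n) :
    #{i ∈ nearPairs D R | i.1 = a} ≤ D := by
  calc _ ≤ #(Finset.Ioc a.val (a.val + D)) := by
        refine card_le_card_of_injOn (fun i => i.2.val) (fun i hi => ?_) fun i hi i' hi' h => ?_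
        · simp only [nearPairs, coe_filter, mem_filter, mem_univ, true_and, Set.mem_ofPred_eq] at hi
          simp only [coe_Ioc, Set.mem_Ioc]
          obtain ⟨⟨_, _, h1, h2⟩, rfl⟩ := hi
          exact ⟨h1, h2⟩
        · simp only [coe_filter, Set.mem_ofPred_eq] at hi hi'
          exact Prod.ext (hi.2.trans hi'.2.symm) (Fin.ext h)
    _ = D := by simp

lemma card_nearPairs_snd_le (D : ℕ) (R : Finset (Fin n)) (a : Fin n) :
    #{i ∈ nearPairs D R | i.2 = a} ≤ D := by
  calc _ ≤ #(Finset.Ico (a.val - D) a.val) := by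
        refine card_le_card_of_injOn (fun i => i.1.val) (fun i hi => ?_) fun i hi i' hi' h => ?_
        · simp only [nearPairs, coe_filter, mem_filter, mem_univ, true_and, Set.mem_ofPred_eq] at hi
          simp only [coe_Ico, Set.mem_Ico]
          obtain ⟨⟨_, _, h1, h2⟩, rfl⟩ := hi
          exact ⟨by omega, h1⟩
        · simp only [coe_filter, Set.mem_ofPred_eq] at hi hi'
          exact Prod.ext (Fin.ext h) (hi.2.trans hi'.2.symm)
    _ ≤ D := by simp; omega

lemma le_card_nearPairs (D : ℕ) (R : Finset (Fin n)) :
    (n - D) * D ≤ #(nearPairs D R) + 2 * #R * D := by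
  have hfull : (n - D) * D ≤ #(nearPairs D (∅ : Finset (Fin n))) := by
    have := card_le_card_of_injOn (s := (univ : Finset (Fin (n - D) × Fin D)))
      (t := nearPairs D (∅ : Finset (Fin n)))
      (fun q => (⟨q.1.val, by omega⟩, ⟨q.1.val + q.2.val + 1, by omega⟩))
      (fun q _ => by simp [nearPairs, ← Fin.val_fin_lt, add_assoc])
      (fun q _ q' _ h => by
        simp only [Prod.mk.injEq, Fin.mk.injEq] at h
        exact Prod.ext (Fin.ext h.1) (Fin.ext (by omega)))
    simpa using this
  have hsub : nearPairs D (∅ : Finset (Fin n)) ⊆ nearPairs D R ∪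
      (R.biUnion (fun a => {i ∈ nearPairs D ∅ | i.1 = a}) ∪
        R.biUnion (fun a => {i ∈ nearPairs D ∅ | i.2 = a})) := by
    intro i hi
    simp only [mem_union, mem_biUnion, mem_filter, hi, true_and]
    simp only [nearPairs, mem_filter, mem_univ, true_and] at hi ⊢
    by_cases h1 : i.1 ∈ R
    · exact Or.inr (Or.inl ⟨_, h1, rfl⟩)
    by_cases h2 : i.2 ∈ R
    · exact Or.inr (Or.inr ⟨_, h2, rfl⟩)
    exact Or.inl ⟨h1, h2, hi.2.2⟩
  have h1 := (card_le_card hsub).trans ((card_union_le _ _).trans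
    (Nat.add_le_add_left (card_union_le _ _) _))
  have h2 := card_biUnion_le_card_mul R (fun a => {i ∈ nearPairs D ∅ | i.1 = a}) D
    fun a _ => card_nearPairs_fst_le D ∅ a
  have h3 := card_biUnion_le_card_mul R (fun a => {i ∈ nearPairs D ∅ | i.2 = a}) D
    fun a _ => card_nearPairs_snd_le D ∅ a
  nlinarith

lemma le_card_lowCols (C : Finset (Fin n)) : n / 2 ≤ #(lowCols C) + #C := by
  refine le_trans ?_ (card_union_le _ _)
  have := card_le_card_of_injOn (s := (univ : Finset (Fin (n / 2)))) (t := lowCols C ∪ C)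
    (fun q => ⟨q.val, by omega⟩)
    (fun q _ => by simp [lowCols]; by_cases h : (⟨q.val, by omega⟩ : Fin n) ∈ C <;> simp [h]; omega)
    (fun q _ q' _ h => Fin.ext (by simpa using h))
  simpa using this

lemma le_card_highCols (C : Finset (Fin n)) : n / 2 ≤ #(highCols C) + #C := by
  refine le_trans ?_ (card_union_le _ _)
  have := card_le_card_of_injOn (s := (univ : Finset (Fin (n / 2)))) (t := highCols C ∪ C)
    (fun q => ⟨q.val + (n - n / 2), by omega⟩)
    (fun q _ => by
      simp [highCols]
      by_cases h : (⟨q.val + (n - n / 2), by omega⟩ : Fin n) ∈ C <;> simp [h]; omega)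
    (fun q _ q' _ h => Fin.ext (by simpa using h))
  simpa using this

lemma bernProb_no_cycle_le {p : ℝ} (h0 : 0 ≤ p) (h1 : p ≤ 1) (D : ℕ) (R C : Finset (Fin n))
    (hsmall : p ^ 3 * ((2 * D) * (2 * n)) + p ^ 2 * (2 * D) + p ^ 2 * (2 * n) ≤ 1 / 2) :
    bernProb p (fun x => ∀ q ∈ nearPairs D R ×ˢ (lowCols C ×ˢ highCols C),
      ¬ ∀ e ∈ cycleEdges q, x e = true) ≤
        (1 - p ^ 4 / 2) ^ (#(nearPairs D R) * (#(lowCols C) * #(highCols C))) := by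
  have hQ : ∀ j ∈ lowCols C ×ˢ highCols C, ∀ j' ∈ lowCols C ×ˢ highCols C, j.1 ≠ j'.2 := by
    intro j hj j' hj' h
    simp only [lowCols, highCols, mem_product, mem_filter] at hj hj'
    have := congrArg Fin.val h
    omega
  have hQ1 : ∀ a, #{i ∈ lowCols C ×ˢ highCols C | i.1 = a} ≤ n := fun a => by
    calc _ ≤ #(univ : Finset (Fin n)) := card_le_card_of_injOn Prod.snd (by simp) (by
          intro i hi i' hi' h
          simp only [coe_filter, Set.mem_ofPred_eq] at hi hi'
          exact Prod.ext (hi.2.trans hi'.2.symm) h)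
      _ = n := by simp
  have hQ2 : ∀ a, #{i ∈ lowCols C ×ˢ highCols C | i.2 = a} ≤ n := fun a => by
    calc _ ≤ #(univ : Finset (Fin n)) := card_le_card_of_injOn Prod.fst (by simp) (by
          intro i hi i' hi' h
          simp only [coe_filter, Set.mem_ofPred_eq] at hi hi'
          exact Prod.ext h (hi.2.trans hi'.2.symm))
      _ = n := by simp
  have := bernProb_forall_not_le h0 h1 cycleEdges 4
    (nearPairs D R ×ˢ (lowCols C ×ˢ highCols C))
    (fun q hq => card_cycleEdges (hQ _ (mem_product.1 hq).2 _ (mem_product.1 hq).2))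
    (fun s hs => by
      refine (sum_overlap_le h0 _ _ D n (card_nearPairs_fst_le D R)
        (card_nearPairs_snd_le D R) hQ1 hQ2 hQ hs).trans ?_
      simpa using hsmall)
  simpa only [card_product] using this

end Family

section Numerics

lemma two_pow_le_sq_mul_cube {x p : ℝ} (hx : 0 < x)
    (h : 2 ^ 9 * x ^ (-(2 : ℝ) / 3) ≤ p) : 2 ^ 27 ≤ x ^ 2 * p ^ 3 := by
  have h1 : (2 ^ 9 * x ^ (-(2 : ℝ) / 3)) ^ 3 ≤ p ^ 3 := pow_le_pow_left₀ (by positivity) h 3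
  have h2 : (x ^ (-(2 : ℝ) / 3)) ^ 3 * x ^ 2 = 1 := by
    rw [← Real.rpow_natCast, ← Real.rpow_mul hx.le, ← Real.rpow_natCast, ← Real.rpow_add hx]
    norm_num
  calc (2 : ℝ) ^ 27 = (2 ^ 9 * x ^ (-(2 : ℝ) / 3)) ^ 3 * x ^ 2 := by
        rw [mul_pow, mul_assoc, h2]; norm_num
    _ ≤ p ^ 3 * x ^ 2 := mul_le_mul_of_nonneg_right h1 (by positivity)
    _ = _ := mul_comm _ _

lemma mul_sq_le_two_pow {x p : ℝ} (hx : 0 < x) (hp : 0 ≤ p)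
    (h : p ≤ Real.exp (-52) / 2 ^ 8 * x ^ (-(1 : ℝ) / 2)) : x * p ^ 2 ≤ 1 / 2 ^ 16 := by
  have h1 := pow_le_pow_left₀ hp h 2
  have h2 : (x ^ (-(1 : ℝ) / 2)) ^ 2 * x = 1 := by
    nth_rewrite 2 [← Real.rpow_one x]
    rw [← Real.rpow_natCast, ← Real.rpow_mul hx.le, ← Real.rpow_add hx]
    norm_num
  have h3 : Real.exp (-52) ^ 2 ≤ 1 :=
    pow_le_one₀ (Real.exp_pos _).le (Real.exp_le_one_iff.2 (by norm_num))
  calc x * p ^ 2 ≤ x * (Real.exp (-52) / 2 ^ 8 * x ^ (-(1 : ℝ) / 2)) ^ 2 :=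
        mul_le_mul_of_nonneg_left h1 hx.le
    _ = Real.exp (-52) ^ 2 / 2 ^ 16 * ((x ^ (-(1 : ℝ) / 2)) ^ 2 * x) := by ring
    _ ≤ 1 / 2 ^ 16 := by rw [h2, mul_one]; gcongr

variable {x p : ℝ}

lemma two_pow_le_mul (hx : 2 ^ 48 ≤ x) (hp : 0 < p) (h : 2 ^ 27 ≤ x ^ 2 * p ^ 3) :
    2 ^ 25 ≤ x * p := by
  have hx0 : 0 < x := lt_of_lt_of_le (by positivity) hx
  refine le_of_pow_le_pow_left₀ (n := 3) (by norm_num) (by positivity) ?_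
  calc ((2 : ℝ) ^ 25) ^ 3 = 2 ^ 48 * 2 ^ 27 := by norm_num
    _ ≤ x * (x ^ 2 * p ^ 3) := by gcongr
    _ = _ := by ring

lemma two_pow_le_cube_mul (hx : 1 ≤ x) (hp : 0 < p) (h : 2 ^ 27 ≤ x ^ 2 * p ^ 3) :
    2 ^ 36 ≤ x ^ 3 * p ^ 4 := by
  refine le_of_pow_le_pow_left₀ (n := 3) (by norm_num) (by positivity) ?_
  calc ((2 : ℝ) ^ 36) ^ 3 = 1 * (2 ^ 27) ^ 4 := by norm_num
    _ ≤ x * (x ^ 2 * p ^ 3) ^ 4 := by gcongr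
    _ = _ := by ring

variable {d : ℝ}

lemma overlap_le_half (hx : 2 ^ 48 ≤ x) (hp : 0 < p) (h : 2 ^ 27 ≤ x ^ 2 * p ^ 3)
    (h' : x * p ^ 2 ≤ 1 / 2 ^ 16) (hd : d ≤ 2 ^ 20 / (x ^ 2 * p ^ 4)) :
    p ^ 3 * ((2 * d) * (2 * x)) + p ^ 2 * (2 * d) + p ^ 2 * (2 * x) ≤ 1 / 2 := by
  have hx0 : 0 < x := lt_of_lt_of_le (by positivity) hx
  have hxp := two_pow_le_mul hx hp h
  have hy : 0 < x * p := by positivity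
  have e1 : p ^ 3 * ((2 * d) * (2 * x)) ≤ 1 / 8 := by
    calc p ^ 3 * ((2 * d) * (2 * x)) = 4 * p ^ 3 * x * d := by ring
      _ ≤ 4 * p ^ 3 * x * (2 ^ 20 / (x ^ 2 * p ^ 4)) := by gcongr
      _ = 2 ^ 22 / (x * p) := by field_simp; norm_num
      _ ≤ 2 ^ 22 / 2 ^ 25 := by gcongr
      _ = 1 / 8 := by norm_num
  have e2 : p ^ 2 * (2 * d) ≤ 1 / 8 := by
    calc p ^ 2 * (2 * d) = 2 * p ^ 2 * d := by ring
      _ ≤ 2 * p ^ 2 * (2 ^ 20 / (x ^ 2 * p ^ 4)) := by gcongr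
      _ = 2 ^ 21 / (x * p) ^ 2 := by field_simp
      _ ≤ 2 ^ 21 / (2 ^ 25) ^ 2 := by gcongr
      _ ≤ 1 / 8 := by norm_num
  linarith

lemma eight_mul_le_of_counts {D P L H r c : ℝ} (hx : 2 ^ 48 ≤ x) (hp : 0 < p)
    (h : 2 ^ 27 ≤ x ^ 2 * p ^ 3) (hD : D ≤ 2 ^ 20 / (x ^ 2 * p ^ 4))
    (hD' : 2 ^ 20 / (x ^ 2 * p ^ 4) ≤ 2 * D) (hr : 50 * r ≤ x) (hc : 50 * c ≤ x)
    (hP : (x - D) * D ≤ P + 2 * r * D) (hL : x ≤ 2 * (L + c) + 1) (hH : x ≤ 2 * (H + c) + 1) :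
    8 * x ≤ P * (L * H) * p ^ 4 := by
  have hx0 : 0 < x := lt_of_lt_of_le (by positivity) hx
  have hx1 : (1000 : ℝ) ≤ x := le_trans (by norm_num) hx
  have hDx : D ≤ x / 4 := by
    refine hD.trans ?_
    rw [div_le_iff₀ (by positivity)]
    have := two_pow_le_cube_mul (by linarith) hp h
    nlinarith
  have hD0 : 0 < D := by
    have : 0 < 2 ^ 20 / (x ^ 2 * p ^ 4) := by positivity
    linarith
  have hP' : x / 2 * D ≤ P := by nlinarith
  have hL' : x / 4 ≤ L := by linarith
  have hH' : x / 4 ≤ H := by linarith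
  have hP0 : 0 ≤ P := le_trans (by positivity) hP'
  have hL0 : 0 ≤ L := le_trans (by positivity) hL'
  have hDp : 2 ^ 20 ≤ 2 * D * (x ^ 2 * p ^ 4) := by rwa [div_le_iff₀ (by positivity)] at hD'
  calc 8 * x ≤ x / 64 * 2 ^ 20 := by linarith
    _ ≤ x / 64 * (2 * D * (x ^ 2 * p ^ 4)) := by gcongr
    _ = x / 2 * D * (x / 4 * (x / 4)) * p ^ 4 := by ring
    _ ≤ P * (L * H) * p ^ 4 := by gcongr

lemma one_sub_half_pow_le_exp (hp : p ≤ 1) {N k : ℕ} (hN : 8 * x ≤ N * p ^ k) (h0 : 0 ≤ p) :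
    (1 - p ^ k / 2) ^ N ≤ Real.exp (-4 * x) := by
  have hk : p ^ k ≤ 1 := pow_le_one₀ h0 hp
  calc (1 - p ^ k / 2) ^ N ≤ (Real.exp (-(p ^ k / 2))) ^ N :=
        pow_le_pow_left₀ (by linarith) (Real.one_sub_le_exp_neg _) N
    _ = Real.exp (N * -(p ^ k / 2)) := (Real.exp_nat_mul _ _).symm
    _ ≤ _ := Real.exp_le_exp.2 (by linarith)

end Numerics

/-- A maximal family of vertex-disjoint members of `Q` meets, in rows or in columns, every
member of `Q`. -/
lemma exists_maximal_disjoint {n : ℕ} (Q : (Fin n × Fin n) × (Fin n × Fin n) → Prop) :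
    ∃ M : Finset ((Fin n × Fin n) × (Fin n × Fin n)), (∀ q ∈ M, Q q) ∧
      (∀ q ∈ M, ∀ q' ∈ M, q ≠ q' → Disjoint ({q.1.1, q.1.2} : Finset (Fin n)) {q'.1.1, q'.1.2} ∧
        Disjoint ({q.2.1, q.2.2} : Finset (Fin n)) {q'.2.1, q'.2.2}) ∧
      ∀ q, Q q → ¬ (Disjoint {q.1.1, q.1.2} (M.biUnion fun q => {q.1.1, q.1.2}) ∧
        Disjoint {q.2.1, q.2.2} (M.biUnion fun q => {q.2.1, q.2.2})) := by
  classical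
  set F : Finset (Finset ((Fin n × Fin n) × (Fin n × Fin n))) :=
    {M | (∀ q ∈ M, Q q) ∧ ∀ q ∈ M, ∀ q' ∈ M, q ≠ q' →
        Disjoint ({q.1.1, q.1.2} : Finset (Fin n)) {q'.1.1, q'.1.2} ∧
        Disjoint ({q.2.1, q.2.2} : Finset (Fin n)) {q'.2.1, q'.2.2}} with hF
  obtain ⟨M, hM, hmax⟩ := exists_max_image F card ⟨∅, by simp [hF]⟩
  have hM' := hM
  rw [hF, mem_filter] at hM'
  refine ⟨M, hM'.2.1, hM'.2.2, fun q hq ⟨hr, hc⟩ => ?_⟩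
  rw [disjoint_biUnion_right] at hr hc
  have hqM : q ∉ M := fun h => by simpa using hr q h
  have hins : insert q M ∈ F := by
    rw [hF, mem_filter]
    refine ⟨mem_univ _, forall_mem_insert _ _ _ |>.2 ⟨hq, hM'.2.1⟩, ?_⟩
    intro a ha b hb hab
    rcases mem_insert.1 ha with rfl | ha' <;> rcases mem_insert.1 hb with rfl | hb'
    · exact absurd rfl hab
    · exact ⟨hr b hb', hc b hb'⟩
    · exact ⟨(hr a ha').symm, (hc a ha').symm⟩
    · exact hM'.2.2 a ha' b hb' hab
  have := hmax _ hins
  rw [card_insert_of_notMem hqM] at this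
  omega

/-- The pair `(A, B)` encoded by a configuration on labelled edges. -/
def configEquiv (n : ℕ) :
    (Bool × Fin n × Fin n → Bool) ≃ (Fin n → Fin n → Bool) × (Fin n → Fin n → Bool) where
  toFun x := (fun i j => x (true, i, j), fun i j => x (false, i, j))
  invFun ω := fun e => if e.1 then ω.1 e.2.1 e.2.2 else ω.2 e.2.1 e.2.2
  left_inv x := by
    funext ⟨b, i, j⟩
    cases b <;> simp
  right_inv ω := by simp

lemma pairWeight_configEquiv {n : ℕ} {p : ℝ} (h0 : 0 ≤ p) (h1 : p ≤ 1)
    (x : Bool × Fin n × Fin n → Bool) :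
    pairWeight n p (configEquiv n x) = ENNReal.ofReal (bernWeight p x) := by
  have hent : ∀ b, entryWeight p b = ENNReal.ofReal (if b then p else 1 - p) := fun b => by
    cases b <;> simp [entryWeight]
  unfold bernWeight pairWeight
  rw [ENNReal.ofReal_prod_of_nonneg fun e _ => by split_ifs <;> linarith]
  simp only [hent, configEquiv, Equiv.coe_fn_mk, Fintype.prod_prod_type, Fintype.prod_bool]

lemma ofReal_bernProb_le_gameMeasure {n : ℕ} {p : ℝ} (h0 : 0 ≤ p) (h1 : p ≤ 1)
    (S : Set ((Fin n → Fin n → Bool) × (Fin n → Fin n → Bool))) :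
    ENNReal.ofReal (bernProb p fun x => configEquiv n x ∈ S) ≤ gameMeasure n p S := by
  classical
  refine le_trans (le_of_eq ?_) (Measure.le_sum_apply _ _)
  rw [tsum_fintype, ← (configEquiv n).sum_comp, bernProb, ENNReal.ofReal_sum_of_nonneg]
  · refine sum_congr rfl fun x _ => ?_
    rw [Measure.smul_apply, Measure.dirac_apply, pairWeight_configEquiv h0 h1,
      ENNReal.ofReal_mul (bernWeight_nonneg h0 h1 x), smul_eq_mul]
    by_cases h : configEquiv n x ∈ S <;> simp [h]
  · exact fun x _ => mul_nonneg (bernWeight_nonneg h0 h1 x) (by split_ifs <;> norm_num)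

lemma injective_vecCons_pair {α : Type*} {a b : α} (h : a ≠ b) :
    Function.Injective (![a, b] : Fin 2 → α) := by
  intro k k' hk
  fin_cases k <;> fin_cases k' <;> simp_all

lemma vecCons_pair_ne_of_disjoint {α : Type*} [DecidableEq α] {a b c d : α}
    (h : Disjoint ({a, b} : Finset α) {c, d}) (k k' : Fin 2) :
    (![a, b] : Fin 2 → α) k ≠ (![c, d] : Fin 2 → α) k' := by
  have hmem : ∀ (a b : α) (k : Fin 2), (![a, b] : Fin 2 → α) k ∈ ({a, b} : Finset α) := by
    intro a b k
    fin_cases k <;> simp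
  exact disjoint_iff_ne.1 h _ (hmem a b k) _ (hmem c d k')

/-- If no family of `n / 100` disjoint near cycles exists, then few rows and columns meet all
near cycles. -/
lemma exists_small_cover {n : ℕ} (A B : Fin n → Fin n → Bool) {d : ℝ} {D : ℕ} (hD : (D : ℝ) ≤ d)
    (hno : ¬ ∃ m : ℕ, (n : ℝ) / 100 ≤ (m : ℝ) ∧
              ∃ r c : Fin m → ZMod 2 → Fin n,
                (∀ t, IsCycle 2 n A B (r t) (c t)) ∧
                (∀ t, |((r t 0 : Fin n) : ℝ) - ((r t 1 : Fin n) : ℝ)| ≤ d) ∧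
                ∀ s t, s ≠ t → (∀ k k', r s k ≠ r t k') ∧ ∀ k k', c s k ≠ c t k') :
    ∃ R C : Finset (Fin n), 50 * (#R : ℝ) ≤ n ∧ 50 * (#C : ℝ) ≤ n ∧
      ∀ q ∈ nearPairs D R ×ˢ (lowCols C ×ˢ highCols C),
        ¬ ∀ e ∈ cycleEdges q, (configEquiv n).symm (A, B) e = true := by
  obtain ⟨M, hMQ, hMd, hMmax⟩ := exists_maximal_disjoint (n := n)
    fun q => q.1.1 < q.1.2 ∧ q.1.2.val ≤ q.1.1.val + D ∧ q.2.1 ≠ q.2.2 ∧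
      ∀ e ∈ cycleEdges q, (configEquiv n).symm (A, B) e = true
  have hcard : (#M : ℝ) < n / 100 := by
    by_contra! hge
    refine hno ⟨#M, hge, fun t => ![(M.equivFin.symm t).1.1.1, (M.equivFin.symm t).1.1.2],
      fun t => ![(M.equivFin.symm t).1.2.1, (M.equivFin.symm t).1.2.2], fun t => ?_, fun t => ?_,
      fun s t hst => ?_⟩
    · obtain ⟨h1, h2, h3, h4⟩ := hMQ _ (M.equivFin.symm t).2
      simp only [cycleEdges, forall_mem_insert, mem_singleton, forall_eq, configEquiv,
        Equiv.coe_fn_symm_mk, Bool.false_eq_true, if_true, if_false] at h4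
      obtain ⟨h5, h6, h7, h8⟩ := h4
      refine ⟨injective_vecCons_pair h1.ne, injective_vecCons_pair h3, fun k => ?_, fun k => ?_⟩
      · change Fin 2 at k
        fin_cases k
        exacts [h5, h6]
      · change Fin 2 at k
        fin_cases k
        exacts [h7, h8]
    · obtain ⟨h1, h2, -, -⟩ := hMQ _ (M.equivFin.symm t).2
      refine le_trans ?_ hD
      change |(((M.equivFin.symm t).1.1.1 : ℕ) : ℝ) - (((M.equivFin.symm t).1.1.2 : ℕ) : ℝ)| ≤ D
      have h1' : (((M.equivFin.symm t).1.1.1 : ℕ) : ℝ) < ((M.equivFin.symm t).1.1.2 : ℕ) := by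
        exact_mod_cast h1
      have h2' : (((M.equivFin.symm t).1.1.2 : ℕ) : ℝ) ≤ ((M.equivFin.symm t).1.1.1 : ℕ) + D := by
        exact_mod_cast h2
      rw [abs_le]
      constructor <;> linarith
    · have hne : (M.equivFin.symm s).1 ≠ (M.equivFin.symm t).1 := fun h =>
        hst (M.equivFin.symm.injective (Subtype.ext h))
      have := hMd _ (M.equivFin.symm s).2 _ (M.equivFin.symm t).2 hne
      exact ⟨vecCons_pair_ne_of_disjoint this.1, vecCons_pair_ne_of_disjoint this.2⟩
  have hsize : ∀ f : (Fin n × Fin n) × (Fin n × Fin n) → Finset (Fin n), (∀ q, #(f q) ≤ 2) →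
      50 * (#(M.biUnion f) : ℝ) ≤ n := fun f hf => by
    have h : (#(M.biUnion f) : ℝ) ≤ #M * 2 := by
      exact_mod_cast card_biUnion_le_card_mul M f 2 fun q _ => hf q
    linarith
  refine ⟨M.biUnion fun q => {q.1.1, q.1.2}, M.biUnion fun q => {q.2.1, q.2.2},
    hsize _ fun q => card_le_two, hsize _ fun q => card_le_two, fun q hq hall => ?_⟩
  simp only [mem_product, nearPairs, lowCols, highCols, mem_filter, mem_univ, true_and] at hq
  obtain ⟨⟨hr1, hr2, hlt, hle⟩, ⟨hc1, hl⟩, hc2, hh⟩ := hq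
  refine hMmax q ⟨hlt, hle, fun h => ?_, hall⟩ ⟨?_, ?_⟩
  · rw [h] at hl; omega
  · exact disjoint_insert_left.2 ⟨hr1, disjoint_singleton_left.2 hr2⟩
  · exact disjoint_insert_left.2 ⟨hc1, disjoint_singleton_left.2 hc2⟩

theorem pairing_procedure_success :
    ∃ N : ℕ, ∀ n : ℕ, N ≤ n → ∀ p : ℝ,
      2 ^ 9 * (n : ℝ) ^ (-(2 : ℝ) / 3) ≤ p →
      p ≤ Real.exp (-52) / 2 ^ 8 * (n : ℝ) ^ (-(1 : ℝ) / 2) →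
      ENNReal.ofReal (1 - Real.exp (-2 * (n : ℝ))) ≤
        gameMeasure n p
          {ω | (∃ i j : Fin n, ω.1 i j = true ∧ ω.2 i j = true) ∨
            ∃ m : ℕ, (n : ℝ) / 100 ≤ (m : ℝ) ∧
              ∃ r c : Fin m → ZMod 2 → Fin n,
                (∀ t, IsCycle 2 n ω.1 ω.2 (r t) (c t)) ∧
                (∀ t, |((r t 0 : Fin n) : ℝ) - ((r t 1 : Fin n) : ℝ)| ≤
                  2 ^ 20 / ((n : ℝ) ^ 2 * p ^ 4)) ∧
                ∀ s t, s ≠ t → (∀ k k', r s k ≠ r t k') ∧ ∀ k k', c s k ≠ c t k'} := by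
  refine ⟨2 ^ 48, fun n hn p hlo hhi => ?_⟩
  have hx : (2 : ℝ) ^ 48 ≤ n := by exact_mod_cast hn
  have hx0 : (0 : ℝ) < n := lt_of_lt_of_le (by positivity) hx
  have hp : 0 < p := lt_of_lt_of_le (by positivity) hlo
  have hcube := two_pow_le_sq_mul_cube hx0 hlo
  have hsq := mul_sq_le_two_pow hx0 hp.le hhi
  have hp1 : p ≤ 1 := by nlinarith
  set d : ℝ := 2 ^ 20 / ((n : ℝ) ^ 2 * p ^ 4) with hd
  have hd1 : 1 ≤ d := by
    rw [hd, one_le_div (by positivity)]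
    calc (n : ℝ) ^ 2 * p ^ 4 = (n * p ^ 2) ^ 2 := by ring
      _ ≤ (1 / 2 ^ 16) ^ 2 := by gcongr
      _ ≤ 2 ^ 20 := by norm_num
  set D : ℕ := ⌊d⌋₊
  have hDd : (D : ℝ) ≤ d := Nat.floor_le (by linarith)
  have hdD : d ≤ 2 * D := by
    have h1 : d < D + 1 := Nat.lt_floor_add_one d
    have h2 : (1 : ℝ) ≤ D := by exact_mod_cast Nat.one_le_floor_iff d |>.2 hd1
    linarith
  refine le_trans (ENNReal.ofReal_le_ofReal ?_) (ofReal_bernProb_le_gameMeasure hp.le hp1 _)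
  refine one_sub_le_bernProb ?_
  have hbad : ∀ RC : Finset (Fin n) × Finset (Fin n),
      50 * (#RC.1 : ℝ) ≤ n → 50 * (#RC.2 : ℝ) ≤ n →
      bernProb p (fun x => ∀ q ∈ nearPairs D RC.1 ×ˢ (lowCols RC.2 ×ˢ highCols RC.2),
        ¬ ∀ e ∈ cycleEdges q, x e = true) ≤ Real.exp (-4 * n) := by
    rintro ⟨R, C⟩ hR hC
    refine (bernProb_no_cycle_le hp.le hp1 D R C
      (overlap_le_half hx hp hcube hsq hDd)).trans (one_sub_half_pow_le_exp hp1 ?_ hp.le)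
    have hP : ((n : ℝ) - D) * D ≤ #(nearPairs D R) + 2 * #R * D := by
      refine le_trans ?_ (Nat.cast_le (α := ℝ).2 (le_card_nearPairs D R) |>.trans_eq
        (by push_cast; ring))
      push_cast
      gcongr
      rw [sub_le_iff_le_add]
      exact_mod_cast (by omega : n ≤ n - D + D)
    have hL : (n : ℝ) ≤ 2 * (#(lowCols C) + #C) + 1 := by
      have := le_card_lowCols C
      exact_mod_cast (by omega : n ≤ 2 * (#(lowCols C) + #C) + 1)
    have hH : (n : ℝ) ≤ 2 * (#(highCols C) + #C) + 1 := by
      have := le_card_highCols C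
      exact_mod_cast (by omega : n ≤ 2 * (#(highCols C) + #C) + 1)
    have := eight_mul_le_of_counts hx hp hcube hDd hdD hR hC hP hL hH
    push_cast
    exact this
  set F : Finset (Finset (Fin n) × Finset (Fin n)) :=
    {RC | 50 * (#RC.1 : ℝ) ≤ n ∧ 50 * (#RC.2 : ℝ) ≤ n} with hF
  have hFcard : (#F : ℝ) ≤ Real.exp (2 * n) := by
    have h1 : #F ≤ 2 ^ n * 2 ^ n := (card_le_univ F).trans (by simp)
    have h2 : (2 : ℝ) ≤ Real.exp 1 := by linarith [Real.add_one_le_exp 1]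
    calc (#F : ℝ) ≤ 2 ^ n * 2 ^ n := by exact_mod_cast h1
      _ ≤ Real.exp 1 ^ n * Real.exp 1 ^ n := by gcongr
      _ = Real.exp (2 * n) := by
        rw [← Real.exp_nat_mul, ← Real.exp_add]; ring_nf
  calc _ ≤ bernProb p (fun x => ∃ RC ∈ F,
        ∀ q ∈ nearPairs D RC.1 ×ˢ (lowCols RC.2 ×ˢ highCols RC.2),
          ¬ ∀ e ∈ cycleEdges q, x e = true) := by
        refine bernProb_mono hp.le hp1 fun x hxS => ?_
        obtain ⟨R, C, hR, hC, hall⟩ := exists_small_cover (configEquiv n x).1 (configEquiv n x).2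
          hDd fun h => hxS (Or.inr h)
        rw [Prod.mk.eta, Equiv.symm_apply_apply] at hall
        exact ⟨(R, C), mem_filter.2 ⟨mem_univ _, hR, hC⟩, hall⟩
    _ ≤ ∑ RC ∈ F, Real.exp (-4 * n) := (bernProb_exists_le hp.le hp1 F _).trans
        (sum_le_sum fun RC h => hbad RC (mem_filter.1 h).2.1 (mem_filter.1 h).2.2)
    _ = #F * Real.exp (-4 * n) := by rw [sum_const, nsmul_eq_mul]
    _ ≤ Real.exp (2 * n) * Real.exp (-4 * n) := by gcongr
    _ = Real.exp (-2 * n) := by rw [← Real.exp_add]; ring_nf
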